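/- Let c₃, c₅ : ℝ² → ℝ be smooth functions and define the Lagrangian L(a,b,c) = (1/2)c² + c₃(a,b)·c + c₅(a,b). Then for every smooth u : ℝ → ℝ and every z ∈ ℝ, the Euler–Lagrange expression EL(z) = L_u − (d/dz)[L_{u'}] + (d²/dz²)[L_{u''}] along u equals u⁗(z) − F(u(z), u'(z), u''(z)), where F(a,b,c) = c₅ᵦᵦ(a,b)·c + c₅ₐᵦ(a,b)·b − c₅ₐ(a,b) − 2c₃ₐ(a,b)·c − c₃ₐᵦ(a,b)·bc − c₃ₐₐ(a,b)·b², with subscripts a, b denoting partial derivatives with respect to the first and second arguments. In particular, the Euler–Lagrange equation of L is the fourth-order ODE u⁗ = F(u, u', u'') with leading coefficient 1. -/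

import Mathlib

open Real

/-- Partial derivative of a second-order Lagrangian `L(u, u', u'')` with respect to its
first argument `u`. -/
noncomputable def pd1 (L : ℝ × ℝ × ℝ → ℝ) (p : ℝ × ℝ × ℝ) : ℝ :=
  deriv (fun x => L (x, p.2.1, p.2.2)) p.1

/-- Partial derivative with respect to the second argument `u'`. -/
noncomputable def pd2 (L : ℝ × ℝ × ℝ → ℝ) (p : ℝ × ℝ × ℝ) : ℝ :=
  deriv (fun x => L (p.1, x, p.2.2)) p.2.1

/-- Partial derivative with respect to the third argument `u''`. -/
noncomputable def pd3 (L : ℝ × ℝ × ℝ → ℝ) (p : ℝ × ℝ × ℝ) : ℝ :=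
  deriv (fun x => L (p.1, p.2.1, x)) p.2.2

/-- The second-order jet `(u(z), u'(z), u''(z))` of a curve `u`. -/
noncomputable def jet (u : ℝ → ℝ) (z : ℝ) : ℝ × ℝ × ℝ :=
  (u z, deriv u z, deriv (deriv u) z)

/-- The Euler–Lagrange expression `L_u − d/dz[L_{u'}] + d²/dz²[L_{u''}]` along `u`. -/
noncomputable def eulerLagrange (L : ℝ × ℝ × ℝ → ℝ) (u : ℝ → ℝ) (z : ℝ) : ℝ :=
  pd1 L (jet u z) - deriv (fun t => pd2 L (jet u t)) z
    + deriv (deriv (fun t => pd3 L (jet u t))) z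

/-- Partial derivative of a function of two real variables with respect to its
first argument. -/
noncomputable def qd1 (f : ℝ × ℝ → ℝ) (p : ℝ × ℝ) : ℝ :=
  deriv (fun x => f (x, p.2)) p.1

/-- Partial derivative of a function of two real variables with respect to its
second argument. -/
noncomputable def qd2 (f : ℝ × ℝ → ℝ) (p : ℝ × ℝ) : ℝ :=
  deriv (fun x => f (p.1, x)) p.2

lemma qd1_eq_fderiv {f : ℝ × ℝ → ℝ} (hf : Differentiable ℝ f) :
    qd1 f = fun p => fderiv ℝ f p (1, 0) := by
  funext p
  have h : HasDerivAt (fun x : ℝ => (x, p.2)) ((1 : ℝ), (0 : ℝ)) p.1 :=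
    (hasDerivAt_id p.1).prodMk (hasDerivAt_const p.1 p.2)
  exact ((hf p).hasFDerivAt.comp_hasDerivAt p.1 h).deriv

lemma qd2_eq_fderiv {f : ℝ × ℝ → ℝ} (hf : Differentiable ℝ f) :
    qd2 f = fun p => fderiv ℝ f p (0, 1) := by
  funext p
  have h : HasDerivAt (fun x : ℝ => (p.1, x)) ((0 : ℝ), (1 : ℝ)) p.2 :=
    (hasDerivAt_const p.2 p.1).prodMk (hasDerivAt_id p.2)
  exact ((hf p).hasFDerivAt.comp_hasDerivAt p.2 h).deriv

lemma ContDiff.differentiable_of_smooth {E : Type*} [NormedAddCommGroup E] [NormedSpace ℝ E]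
    {f : E → ℝ} (hf : ContDiff ℝ (⊤ : ℕ∞) f) : Differentiable ℝ f :=
  hf.differentiable (by simp)

lemma contDiff_fderiv_apply_of_smooth {E : Type*} [NormedAddCommGroup E] [NormedSpace ℝ E]
    {f : E → ℝ} (hf : ContDiff ℝ (⊤ : ℕ∞) f) (v : E) :
    ContDiff ℝ (⊤ : ℕ∞) (fun p => fderiv ℝ f p v) :=
  (hf.fderiv_right (m := (⊤ : ℕ∞)) (by simp)).clm_apply contDiff_const

lemma contDiff_qd1 {f : ℝ × ℝ → ℝ} (hf : ContDiff ℝ (⊤ : ℕ∞) f) :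
    ContDiff ℝ (⊤ : ℕ∞) (qd1 f) := by
  rw [qd1_eq_fderiv hf.differentiable_of_smooth]
  exact contDiff_fderiv_apply_of_smooth hf _

lemma contDiff_qd2 {f : ℝ × ℝ → ℝ} (hf : ContDiff ℝ (⊤ : ℕ∞) f) :
    ContDiff ℝ (⊤ : ℕ∞) (qd2 f) := by
  rw [qd2_eq_fderiv hf.differentiable_of_smooth]
  exact contDiff_fderiv_apply_of_smooth hf _

lemma qd2_qd1_comm {f : ℝ × ℝ → ℝ} (hf : ContDiff ℝ (⊤ : ℕ∞) f) (p : ℝ × ℝ) :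
    qd2 (qd1 f) p = qd1 (qd2 f) p := by
  have hd : DifferentiableAt ℝ (fderiv ℝ f) p :=
    (hf.fderiv_right (m := (⊤ : ℕ∞)) (by simp)).differentiable (by simp) p
  have happly (v w : ℝ × ℝ) :
      fderiv ℝ (fun q => fderiv ℝ f q v) p w = fderiv ℝ (fderiv ℝ f) p w v := by
    rw [fderiv_clm_apply hd (differentiableAt_const v)]
    simp
  have hsymm : IsSymmSndFDerivAt ℝ f p :=
    hf.contDiffAt.isSymmSndFDerivAt (by
      rw [minSmoothness_of_isRCLikeNormedField]
      exact WithTop.coe_le_coe.2 (le_top : (2 : ℕ∞) ≤ ⊤))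
  rw [qd2_eq_fderiv (contDiff_qd1 hf).differentiable_of_smooth,
    qd1_eq_fderiv (contDiff_qd2 hf).differentiable_of_smooth,
    qd1_eq_fderiv hf.differentiable_of_smooth, qd2_eq_fderiv hf.differentiable_of_smooth]
  simp only [happly]
  exact hsymm.eq _ _

/-- Chain rule along a planar curve, in terms of the partial derivatives `qd1` and `qd2`. -/
lemma hasDerivAt_comp_curve {f : ℝ × ℝ → ℝ} (hf : ContDiff ℝ (⊤ : ℕ∞) f) {x y : ℝ → ℝ}
    {x' y' t : ℝ} (hx : HasDerivAt x x' t) (hy : HasDerivAt y y' t) :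
    HasDerivAt (fun s => f (x s, y s))
      (qd1 f (x t, y t) * x' + qd2 f (x t, y t) * y') t := by
  have hd := hf.differentiable_of_smooth
  have h := (hd (x t, y t)).hasFDerivAt.comp_hasDerivAt t (hx.prodMk hy)
  refine h.congr_deriv ?_
  rw [qd1_eq_fderiv hd, qd2_eq_fderiv hd]
  have hv : (x', y') = x' • ((1 : ℝ), (0 : ℝ)) + y' • ((0 : ℝ), (1 : ℝ)) := by simp
  rw [hv, map_add, map_smul, map_smul]
  simp [mul_comm]

lemma contDiff_deriv_of_smooth {u : ℝ → ℝ} (hu : ContDiff ℝ (⊤ : ℕ∞) u) :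
    ContDiff ℝ (⊤ : ℕ∞) (deriv u) :=
  (contDiff_infty_iff_deriv.1 hu).2

lemma hasDerivAt_of_smooth {u : ℝ → ℝ} (hu : ContDiff ℝ (⊤ : ℕ∞) u) (t : ℝ) :
    HasDerivAt u (deriv u t) t :=
  (hu.differentiable_of_smooth t).hasDerivAt

lemma hasDerivAt_fst_slice {f : ℝ × ℝ → ℝ} (hf : ContDiff ℝ (⊤ : ℕ∞) f) (a b : ℝ) :
    HasDerivAt (fun x => f (x, b)) (qd1 f (a, b)) a := by
  simpa using hasDerivAt_comp_curve hf (hasDerivAt_id a) (hasDerivAt_const a b)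

lemma hasDerivAt_snd_slice {f : ℝ × ℝ → ℝ} (hf : ContDiff ℝ (⊤ : ℕ∞) f) (a b : ℝ) :
    HasDerivAt (fun y => f (a, y)) (qd2 f (a, b)) b := by
  simpa using hasDerivAt_comp_curve hf (hasDerivAt_const b a) (hasDerivAt_id b)


/-- For the special case `c₁ = 1`, `c₂ = 1` of the paper's family, i.e. the Lagrangian
`L = (1/2)u''² + c₃(u,u')u'' + c₅(u,u')`, the Euler–Lagrange expression along a smooth
curve `u` equals `u⁗ − F(u,u',u'')` where
`F(a,b,c) = c₅ᵦᵦ c + c₅ₐᵦ b − c₅ₐ − 2c₃ₐ c − c₃ₐᵦ bc − c₃ₐₐ b²`; in particular the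
Euler–Lagrange equation is the fourth-order ODE `u⁗ = F(u,u',u'')` with leading
coefficient 1. -/
theorem eulerLagrange_fels_case
    (c₃ c₅ : ℝ × ℝ → ℝ) (hc₃ : ContDiff ℝ (⊤ : ℕ∞) c₃) (hc₅ : ContDiff ℝ (⊤ : ℕ∞) c₅)
    (L : ℝ × ℝ × ℝ → ℝ)
    (hL : L = fun p => (1 / 2) * p.2.2 ^ 2 + c₃ (p.1, p.2.1) * p.2.2 + c₅ (p.1, p.2.1))
    (F : ℝ → ℝ → ℝ → ℝ)
    (hF : ∀ a b c : ℝ, F a b c =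
      qd2 (qd2 c₅) (a, b) * c + qd1 (qd2 c₅) (a, b) * b - qd1 c₅ (a, b)
      - 2 * qd1 c₃ (a, b) * c - qd1 (qd2 c₃) (a, b) * b * c
      - qd1 (qd1 c₃) (a, b) * b ^ 2)
    (u : ℝ → ℝ) (hu : ContDiff ℝ (⊤ : ℕ∞) u) :
    (∀ z : ℝ, eulerLagrange L u z =
      deriv (deriv (deriv (deriv u))) z - F (u z) (deriv u z) (deriv (deriv u) z))
    ∧ ((∀ z : ℝ, eulerLagrange L u z = 0) ↔
      (∀ z : ℝ, deriv (deriv (deriv (deriv u))) z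
        = F (u z) (deriv u z) (deriv (deriv u) z))) := by
  have hu₁ := contDiff_deriv_of_smooth hu
  have hu₂ := contDiff_deriv_of_smooth hu₁
  have hu₃ := contDiff_deriv_of_smooth hu₂
  have d₀ := hasDerivAt_of_smooth hu
  have d₁ := hasDerivAt_of_smooth hu₁
  have d₂ := hasDerivAt_of_smooth hu₂
  have d₃ := hasDerivAt_of_smooth hu₃
  have hp1 (a b c : ℝ) : pd1 L (a, b, c) = qd1 c₃ (a, b) * c + qd1 c₅ (a, b) := by
    subst hL
    exact ((((hasDerivAt_fst_slice hc₃ a b).mul_const c).const_add (1 / 2 * c ^ 2)).fun_add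
      (hasDerivAt_fst_slice hc₅ a b)).deriv
  have hp2 (a b c : ℝ) : pd2 L (a, b, c) = qd2 c₃ (a, b) * c + qd2 c₅ (a, b) := by
    subst hL
    exact ((((hasDerivAt_snd_slice hc₃ a b).mul_const c).const_add (1 / 2 * c ^ 2)).fun_add
      (hasDerivAt_snd_slice hc₅ a b)).deriv
  have hp3 (a b c : ℝ) : pd3 L (a, b, c) = c + c₃ (a, b) := by
    subst hL
    have h := (((((hasDerivAt_id c).pow 2).const_mul (1 / 2)).add
      ((hasDerivAt_id c).const_mul (c₃ (a, b)))).add_const (c₅ (a, b))).deriv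
    refine h.trans ?_
    simp
  have main (z : ℝ) : eulerLagrange L u z =
      deriv (deriv (deriv (deriv u))) z - F (u z) (deriv u z) (deriv (deriv u) z) := by
    have chain {f : ℝ × ℝ → ℝ} (hf : ContDiff ℝ (⊤ : ℕ∞) f) (t : ℝ) :=
      hasDerivAt_comp_curve hf (d₀ t) (d₁ t)
    have e2 := (((chain (contDiff_qd2 hc₃) z).fun_mul (d₂ z)).fun_add (chain (contDiff_qd2 hc₅) z)).deriv
    have e3 : deriv (fun t => deriv (deriv u) t + c₃ (u t, deriv u t)) = fun t =>
        deriv (deriv (deriv u)) t + (qd1 c₃ (u t, deriv u t) * deriv u t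
          + qd2 c₃ (u t, deriv u t) * deriv (deriv u) t) :=
      funext fun t => ((d₂ t).fun_add (chain hc₃ t)).deriv
    have e4 := ((d₃ z).fun_add (((chain (contDiff_qd1 hc₃) z).fun_mul (d₁ z)).fun_add
      ((chain (contDiff_qd2 hc₃) z).fun_mul (d₂ z)))).deriv
    simp only [eulerLagrange, jet, hp1, hp2, hp3, e3, hF]
    rw [e2, e4, qd2_qd1_comm hc₃]
    ring
  refine ⟨main, forall_congr' fun z => ?_⟩
  rw [main z, sub_eq_zero]
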